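/- arXiv:2109.01865 — 4 statements merged into one kernel-verified Lean document; each statement's English description precedes it below -/
import Mathlib

section
/- Suppose E ∈ C¹(X,ℝ) and let p(v) = t_v v + w_v^L be a local peak selection of E with respect to L at v ∈ S∖L, where t_v ≥ 0 and w_v^L ∈ L. If (i) p is continuous at v, (ii) t_v > 0, and (iii) g = ∇E(p(v)) ≠ 0, then for any σ ∈ (0,1) there exists α^A > 0 such that E(p(v(α))) < E(p(v)) − σ α t_v ‖g‖² for all α ∈ (0, α^A). -/
open Filter Topology Set
open scoped RealInnerProductSpace ENNReal

noncomputable section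

/-- The half subspace `[L, v] = {t • v + w : t ≥ 0, w ∈ L}`. -/
def halfspaceCone {X : Type*} [NormedAddCommGroup X] [InnerProductSpace ℝ X]
    (L : Submodule ℝ X) (v : X) : Set X :=
  {y | ∃ t : ℝ, 0 ≤ t ∧ ∃ w ∈ (L : Set X), y = t • v + w}

/-- The normalized gradient-step map `v(α) = (v - α g)/‖v - α g‖`. -/
def stepv {X : Type*} [NormedAddCommGroup X] [InnerProductSpace ℝ X] (v g : X) (α : ℝ) : X :=
  ‖v - α • g‖⁻¹ • (v - α • g)

theorem continuousAt_stepv_zero {X : Type*} [NormedAddCommGroup X] [InnerProductSpace ℝ X]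
    {v : X} (hv : v ≠ 0) (g : X) : ContinuousAt (stepv v g) 0 := by
  have h : ContinuousAt (fun α : ℝ => v - α • g) 0 := by fun_prop
  exact (h.norm.inv₀ (by simpa using hv)).smul h

theorem norm_stepv {X : Type*} [NormedAddCommGroup X] [InnerProductSpace ℝ X]
    {v g : X} {α : ℝ} (h : v - α • g ≠ 0) : ‖stepv v g α‖ = 1 := by
  simpa [stepv] using norm_smul_inv_norm (𝕜 := ℝ) h

/-- A vector outside a finite-dimensional subspace is detected by some vector orthogonal to it. -/
theorem exists_mem_orthogonal_inner_ne_zero {X : Type*} [NormedAddCommGroup X]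
    [InnerProductSpace ℝ X] {L : Submodule ℝ X} [FiniteDimensional ℝ L] {v : X} (hv : v ∉ L) :
    ∃ q ∈ Lᗮ, ⟪q, v⟫ ≠ 0 := by
  rw [← L.orthogonal_orthogonal, Submodule.mem_orthogonal] at hv
  push Not at hv
  exact hv

/-- The coefficient of `u` in an element of `[L, u]` is read off by a vector orthogonal to `L`. -/
theorem eq_smul_add_of_mem_halfspaceCone {X : Type*} [NormedAddCommGroup X]
    [InnerProductSpace ℝ X] {L : Submodule ℝ X} {q u x : X} (hq : q ∈ Lᗮ) (hqu : ⟪q, u⟫ ≠ 0)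
    (hx : x ∈ halfspaceCone L u) :
    0 ≤ ⟪q, x⟫ / ⟪q, u⟫ ∧ ∃ w ∈ L, x = (⟪q, x⟫ / ⟪q, u⟫) • u + w := by
  obtain ⟨t, ht, w, hw, rfl⟩ := hx
  have h : ⟪q, t • u + w⟫ / ⟪q, u⟫ = t := by
    rw [inner_add_right, inner_smul_right, Submodule.inner_left_of_mem_orthogonal hw hq, add_zero,
      mul_div_cancel_right₀ _ hqu]
  rw [h]
  exact ⟨ht, w, hw, rfl⟩

/-- Lemma 2.5, normalized Armijo-type descent: if the local peak
selection `p(v) = t_v v + w_v^L` is continuous at `v`, `t_v > 0` and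
`g = ∇E(p(v)) ≠ 0`, then for any `σ ∈ (0,1)` there is `α^A > 0` with
`E(p(v(α))) < E(p(v)) − σ α t_v ‖g‖²` for all `α ∈ (0, α^A)`. -/
theorem statement3
    {X : Type*} [NormedAddCommGroup X] [InnerProductSpace ℝ X] [CompleteSpace X]
    (E : X → ℝ) (hE : ContDiff ℝ 1 E)
    (L : Submodule ℝ X) [FiniteDimensional ℝ L]
    (v : X) (hv : ‖v‖ = 1) (hvL : v ∉ L)
    (p : X → X) (N : Set X) (hN : N ∈ nhds v)
    (hpsel : ∀ u ∈ N, ‖u‖ = 1 →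
      p u ∈ halfspaceCone L u ∧ IsLocalMaxOn E (halfspaceCone L u) (p u))
    (tv : ℝ) (wvL : X) (hdecomp : p v = tv • v + wvL) (hwvL : wvL ∈ L)
    (hpc : ContinuousWithinAt p {u : X | ‖u‖ = 1} v)
    (htv : 0 < tv)
    (hg : gradient E (p v) ≠ 0)
    (σ : ℝ) (hσ : σ ∈ Set.Ioo (0 : ℝ) 1) :
    ∃ αA > 0, ∀ α : ℝ, 0 < α → α < αA →
      E (p (stepv v (gradient E (p v)) α)) <
        E (p v) - σ * α * tv * ‖gradient E (p v)‖ ^ 2 := by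
  obtain ⟨q, hq, hqv⟩ := exists_mem_orthogonal_inner_ne_zero hvL
  have hv0 : v ≠ 0 := norm_ne_zero_iff.1 (by simp [hv])
  have hgrad : HasStrictFDerivAt E (InnerProductSpace.toDual ℝ X (gradient E (p v))) (p v) := by
    have h := hE.contDiffAt (x := p v) |>.hasStrictFDerivAt one_ne_zero
    simpa [gradient] using h
  have hmax := (hpsel v (mem_of_mem_nhds hN) hv).2
  set g := gradient E (p v)
  have hg0 : 0 < ‖g‖ := norm_pos_iff.2 hg
  set c : ℝ → ℝ := fun α => ‖v - α • g‖⁻¹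
  have hid : Tendsto (fun α : ℝ => α) (𝓝[>] 0) (𝓝 0) := tendsto_id.mono_left nhdsWithin_le_nhds
  have hdiff : Tendsto (fun α : ℝ => v - α • g) (𝓝[>] 0) (𝓝 v) := by
    simpa using tendsto_const_nhds.sub (hid.smul_const g)
  have hc : Tendsto c (𝓝[>] 0) (𝓝 1) := by
    simpa [hv] using hdiff.norm.inv₀ (by simp [hv])
  have hne : ∀ᶠ α in 𝓝[>] (0 : ℝ), v - α • g ≠ 0 := hdiff.eventually_ne hv0
  have hstep : Tendsto (stepv v g) (𝓝[>] 0) (𝓝 v) := by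
    have h : stepv v g 0 = v := by simp [stepv, hv]
    simpa [ContinuousAt, h] using (continuousAt_stepv_zero hv0 g).mono_left nhdsWithin_le_nhds
  have hp : Tendsto (fun α => p (stepv v g α)) (𝓝[>] 0) (𝓝 (p v)) :=
    hpc.tendsto.comp (tendsto_nhdsWithin_iff.2 ⟨hstep, hne.mono fun α h => norm_stepv h⟩)
  have hqstep : Tendsto (fun α => ⟪q, stepv v g α⟫) (𝓝[>] 0) (𝓝 ⟪q, v⟫) :=
    tendsto_const_nhds.inner hstep
  set T : ℝ → ℝ := fun α => ⟪q, p (stepv v g α)⟫ / ⟪q, stepv v g α⟫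
  have hT : Tendsto T (𝓝[>] 0) (𝓝 tv) := by
    have h : ⟪q, p v⟫ / ⟪q, v⟫ = tv := by
      rw [hdecomp, inner_add_right, inner_smul_right,
        Submodule.inner_left_of_mem_orthogonal hwvL hq, add_zero, mul_div_cancel_right₀ _ hqv]
    exact h ▸ (tendsto_const_nhds.inner hp).div hqstep hqv
  have hTc : Tendsto (fun α => T α * c α) (𝓝[>] 0) (𝓝 tv) := by simpa using hT.mul hc
  -- the point of `[L, v]` obtained from `p (v(α))` by undoing the gradient step
  set y : ℝ → X := fun α => p (stepv v g α) + (T α * c α * α) • g with hy_def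
  have hy : Tendsto y (𝓝[>] 0) (𝓝 (p v)) := by
    simpa using hp.add ((hTc.mul hid).smul_const g)
  have hycone : ∀ᶠ α in 𝓝[>] (0 : ℝ), y α ∈ halfspaceCone L v := by
    filter_upwards [hne, hqstep.eventually_ne hqv, hstep.eventually hN] with α hα hqα hNα
    obtain ⟨ht, w, hw, hpw⟩ :=
      eq_smul_add_of_mem_halfspaceCone hq hqα (hpsel _ hNα (norm_stepv hα)).1
    refine ⟨T α * c α, mul_nonneg ht (by positivity), w, hw, ?_⟩
    change p (stepv v g α) = T α • (c α • (v - α • g)) + w at hpw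
    change p (stepv v g α) + _ = _
    rw [hpw]
    module
  have hyE : ∀ᶠ α in 𝓝[>] (0 : ℝ), E (y α) ≤ E (p v) :=
    (tendsto_nhdsWithin_iff.2 ⟨hy, hycone⟩).eventually hmax
  have hlin := (hp.prodMk_nhds hy).eventually
    (hgrad.isLittleO.def (c := (1 - σ) / 2 * ‖g‖) (mul_pos (by linarith [hσ.2]) hg0))
  have hbig : ∀ᶠ α in 𝓝[>] (0 : ℝ), σ * tv < T α * c α * ((1 + σ) / 2) := by
    refine (hTc.mul_const ((1 + σ) / 2)).eventually_const_lt ?_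
    nlinarith [hσ.2]
  have key : ∀ᶠ α in 𝓝[>] (0 : ℝ),
      E (p (stepv v g α)) < E (p v) - σ * α * tv * ‖g‖ ^ 2 := by
    filter_upwards [hyE, hlin, hbig, hTc.eventually_const_lt htv, self_mem_nhdsWithin]
      with α hle hlin hbig hpos hα
    have hα : 0 < α := hα
    have hsub : p (stepv v g α) - y α = -((T α * c α * α) • g) := by simp [hy_def]
    have ha : 0 < T α * c α * α := mul_pos hpos hα
    simp only [hsub, map_neg, map_smul, InnerProductSpace.toDual_apply_apply, norm_neg,
      norm_smul, Real.norm_of_nonneg ha.le, real_inner_self_eq_norm_sq, smul_eq_mul] at hlin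
    have hup := (le_abs_self _).trans hlin
    have hlt := mul_lt_mul_of_pos_right hbig (mul_pos hα (pow_pos hg0 2))
    nlinarith
  obtain ⟨αA, hαA, h⟩ := mem_nhdsGT_iff_exists_Ioo_subset.1 key
  exact ⟨αA, hαA, fun α h₀ h₁ => h ⟨h₀, h₁⟩⟩
end
end

section
/- If E ∈ C¹(X,ℝ) has a local peak selection p with respect to L at v_* ∈ S∖L, written p(v_*) = t_{v_*} v_* + w_{v_*}^L with t_{v_*} ≥ 0 and w_{v_*}^L ∈ L, satisfying (i) p is continuous at v_*, (ii) t_{v_*} > 0, and (iii) v_* is a local minimizer of the map v ↦ E(p(v)) on S∖L, then p(v_*) ∉ L is a critical point of E, i.e., E'(p(v_*)) = 0 and p(v_*) ∉ L. -/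
open Filter Topology Set
open scoped RealInnerProductSpace ENNReal

noncomputable section

/-- Along the normalized perturbations of `v` in a direction `h`, a local peak selection whose
energy is locally minimal at `v` forces the derivative of `E` in the direction `h` to be
nonnegative. The functional `f` vanishes on `L` and separates `v` from it. -/
theorem fderiv_apply_nonneg_of_peakSelection
    {X : Type*} [NormedAddCommGroup X] [InnerProductSpace ℝ X]
    {E : X → ℝ} {E' : X →L[ℝ] ℝ} {L : Submodule ℝ X} {v : X} (hv : ‖v‖ = 1)
    {p : X → X} (hE : HasStrictFDerivAt E E' (p v)) {N : Set X} (hN : N ∈ 𝓝 v)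
    (hmem : ∀ u ∈ N, ‖u‖ = 1 → p u ∈ halfspaceCone L u)
    (hmax : IsLocalMaxOn E (halfspaceCone L v) (p v))
    {f : X →L[ℝ] ℝ} (hfL : ∀ w ∈ L, f w = 0) (hfv : f v ≠ 0) (hfp : 0 < f (p v) / f v)
    (hpc : ContinuousWithinAt p {u : X | ‖u‖ = 1} v)
    (hmin : IsLocalMinOn (fun u => E (p u)) ({u : X | ‖u‖ = 1} \ (L : Set X)) v) (h : X) :
    0 ≤ E' h := by
  by_contra! hneg
  set l : Filter ℝ := 𝓝[>] 0
  have hs : Tendsto (fun s : ℝ => s) l (𝓝 0) := nhdsWithin_le_nhds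
  have hy : Tendsto (fun s : ℝ => v + s • h) l (𝓝 v) := by
    simpa using tendsto_const_nhds.add (hs.smul_const h)
  have hc : Tendsto (fun s : ℝ => ‖v + s • h‖⁻¹) l (𝓝 1) := by
    simpa [hv] using hy.norm.inv₀ (by simp [hv])
  set u : ℝ → X := fun s => ‖v + s • h‖⁻¹ • (v + s • h)
  have hu : Tendsto u l (𝓝 v) := by
    simpa only [one_smul] using hc.smul hy
  have hfy : Tendsto (fun s : ℝ => f (v + s • h)) l (𝓝 (f v)) :=
    (f.continuous.tendsto v).comp hy
  have hfy0 : ∀ᶠ s in l, f (v + s • h) ≠ 0 := hfy.eventually_ne hfv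
  have hpos : ∀ᶠ s in l, 0 < ‖v + s • h‖⁻¹ := hc.eventually_const_lt one_pos
  have hunorm : ∀ᶠ s in l, ‖u s‖ = 1 := by
    filter_upwards [hpos] with s hs
    rw [norm_smul, norm_inv, norm_norm]
    exact inv_mul_cancel₀ (inv_pos.1 hs).ne'
  have huL : ∀ᶠ s in l, u s ∉ L := by
    filter_upwards [hfy0, hpos] with s h0 hp hL
    have := hfL _ hL
    rw [map_smul, smul_eq_mul] at this
    exact mul_ne_zero hp.ne' h0 this
  have hpu : Tendsto (fun s => p (u s)) l (𝓝 (p v)) :=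
    hpc.tendsto.comp (tendsto_nhdsWithin_iff.2 ⟨hu, hunorm⟩)
  set τ : ℝ → ℝ := fun s => f (p (u s)) / f (v + s • h)
  have hτ : Tendsto τ l (𝓝 (f (p v) / f v)) :=
    ((f.continuous.tendsto _).comp hpu).div hfy hfv
  have hτpos : ∀ᶠ s in l, 0 < τ s := hτ.eventually_const_lt hfp
  set q : ℝ → X := fun s => p (u s) - (τ s * s) • h
  have hq : Tendsto q l (𝓝 (p v)) := by
    simpa using hpu.sub ((hτ.mul hs).smul_const h)
  have hqmem : ∀ᶠ s in l, q s ∈ halfspaceCone L v := by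
    filter_upwards [hfy0, hτpos, hunorm, hu.eventually hN] with s h0 ht hn hNs
    obtain ⟨t, -, w, hw, hpw⟩ := hmem _ hNs hn
    have hts : τ s = t * ‖v + s • h‖⁻¹ := by
      rw [div_eq_iff h0, hpw, map_add, hfL w hw, map_smul, map_smul]
      simp only [smul_eq_mul]
      ring
    refine ⟨τ s, ht.le, w, hw, ?_⟩
    simp only [q, hpw, hts, u]
    module
  have hqle : ∀ᶠ s in l, E (q s) ≤ E (p v) :=
    (tendsto_nhdsWithin_iff.2 ⟨hq, hqmem⟩).eventually hmax
  have hple : ∀ᶠ s in l, E (p v) ≤ E (p (u s)) :=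
    (tendsto_nhdsWithin_iff.2 ⟨hu, hunorm.and huL⟩).eventually hmin
  obtain ⟨ε, hε, hεh⟩ : ∃ ε : ℝ, 0 < ε ∧ ε * ‖h‖ < -E' h :=
    exists_pos_mul_lt (neg_pos.2 hneg) ‖h‖ |>.imp fun ε hε => ⟨hε.1, mul_comm ‖h‖ ε ▸ hε.2⟩
  have hstrict := (hpu.prodMk_nhds hq).eventually (hE.isLittleO.def hε)
  have hspos : ∀ᶠ s in l, 0 < s := self_mem_nhdsWithin
  obtain ⟨s, hd, hle, hle', ht, hs0⟩ :=
    (hstrict.and (hqle.and (hple.and (hτpos.and hspos)))).exists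
  have hts : 0 < τ s * s := mul_pos ht hs0
  have hsub : p (u s) - q s = (τ s * s) • h := sub_sub_cancel _ _
  simp only [hsub, map_smul, norm_smul, smul_eq_mul, Real.norm_of_nonneg hts.le] at hd
  have hd' := (le_abs_self _).trans hd
  have := mul_lt_mul_of_pos_left hεh hts
  linarith

/-- Theorem 2.6, local minimax characterization: if the local peak
selection `p` is continuous at `v_*`, `t_{v_*} > 0`, and `v_*` is a local minimizer of
`v ↦ E(p(v))` on `S∖L`, then `p(v_*) ∉ L` is a critical point of `E`. -/
theorem statement4
    {X : Type*} [NormedAddCommGroup X] [InnerProductSpace ℝ X] [CompleteSpace X]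
    (E : X → ℝ) (hE : ContDiff ℝ 1 E)
    (L : Submodule ℝ X) [FiniteDimensional ℝ L]
    (vstar : X) (hv : ‖vstar‖ = 1) (hvL : vstar ∉ L)
    (p : X → X) (N : Set X) (hN : N ∈ nhds vstar)
    (hpsel : ∀ u ∈ N, ‖u‖ = 1 →
      p u ∈ halfspaceCone L u ∧ IsLocalMaxOn E (halfspaceCone L u) (p u))
    (tv : ℝ) (wvL : X) (hdecomp : p vstar = tv • vstar + wvL) (hwvL : wvL ∈ L)
    (hpc : ContinuousWithinAt p {u : X | ‖u‖ = 1} vstar)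
    (htv : 0 < tv)
    (hmin : IsLocalMinOn (fun u => E (p u)) ({u : X | ‖u‖ = 1} \ (L : Set X)) vstar) :
    p vstar ∉ L ∧ fderiv ℝ E (p vstar) = 0 := by
  obtain ⟨f, hfv, hfL⟩ : ∃ f : X →L[ℝ] ℝ, f vstar ≠ 0 ∧ ∀ w ∈ L, f w = 0 := by
    let n := vstar - L.starProjection vstar
    have hn : n ∈ Lᗮ := L.sub_starProjection_mem_orthogonal vstar
    refine ⟨innerSL ℝ n, fun h0 => hvL ?_, fun w hw => L.inner_left_of_mem_orthogonal hw hn⟩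
    have hP : inner ℝ n (L.starProjection vstar) = 0 :=
      L.inner_left_of_mem_orthogonal (L.starProjection_apply_mem vstar) hn
    have hn0 : n = 0 := by
      rw [← inner_self_eq_zero (𝕜 := ℝ)]
      nth_rewrite 2 [show n = vstar - L.starProjection vstar from rfl]
      rw [inner_sub_right, hP, sub_zero]
      exact h0
    rw [sub_eq_zero.1 hn0]
    exact L.starProjection_apply_mem vstar
  have hfp : f (p vstar) = tv * f vstar := by
    simp [hdecomp, hfL wvL hwvL]
  have hdiff : HasStrictFDerivAt E (fderiv ℝ E (p vstar)) (p vstar) :=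
    hE.contDiffAt.hasStrictFDerivAt one_ne_zero
  have hnonneg : ∀ h, 0 ≤ fderiv ℝ E (p vstar) h :=
    fderiv_apply_nonneg_of_peakSelection hv hdiff hN (fun u hu hn => (hpsel u hu hn).1)
      (hpsel vstar (mem_of_mem_nhds hN) hv).2 hfL hfv
      (by rwa [hfp, mul_div_cancel_right₀ _ hfv]) hpc hmin
  refine ⟨fun hL => mul_ne_zero htv.ne' hfv (hfp ▸ hfL _ hL), ?_⟩
  ext h
  refine le_antisymm ?_ (hnonneg h)
  simpa using hnonneg (-h)
end
end

section
/- Let E ∈ C¹(X,ℝ) satisfy the (PS) condition. If E has a peak selection p with respect to L, written p(v) = t_v v + w_v^L with v ∈ V_0 and w_v^L ∈ L, satisfying (i) p is continuous on V_0, (ii) t_v ≥ δ for some δ > 0 and all v ∈ V_0, and (iii) inf_{v ∈ V_0} E(p(v)) > −∞, then there exists v_* ∈ V_0 such that p(v_*) ∉ L is a critical point of E and E(p(v_*)) = inf_{v ∈ V_0} E(p(v)). -/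
open Filter Topology Set
open scoped RealInnerProductSpace ENNReal

noncomputable section

/-- The set `V₀ = {v = v⊥ + τ v₀^L ∈ S : v⊥ ∈ L⊥, 0 ≤ τ ≤ 1}`. -/
def V0 {X : Type*} [NormedAddCommGroup X] [InnerProductSpace ℝ X]
    (L : Submodule ℝ X) (v0L : X) : Set X :=
  {v | ‖v‖ = 1 ∧ ∃ w ∈ (Lᗮ : Set X), ∃ τ : ℝ, 0 ≤ τ ∧ τ ≤ 1 ∧ v = w + τ • v0L}

/-- A form of Ekeland's variational principle: a lower semicontinuous function bounded below on a
complete metric space becomes minimized after adding an arbitrarily small multiple of the distance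
to a suitable almost-minimizing point. -/
theorem exists_forall_le_add_mul_dist {α : Type*} [MetricSpace α] [CompleteSpace α] [Nonempty α]
    {f : α → ℝ} (hf : LowerSemicontinuous f) (hb : BddBelow (range f)) {ε : ℝ} (hε : 0 < ε) :
    ∃ x, f x ≤ sInf (range f) + ε ∧ ∀ u, f x ≤ f u + ε * dist x u := by
  let S : α → Set α := fun x => {u | f u + ε * dist x u ≤ f x}
  have hSself : ∀ x, x ∈ S x := fun x => by simp [S]
  have hStrans : ∀ {x y z}, y ∈ S x → z ∈ S y → z ∈ S x := by
    intro x y z hy hz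
    have h := mul_le_mul_of_nonneg_left (dist_triangle x y z) hε.le
    simp only [S, mem_ofPred_eq] at *
    linarith
  have hSclosed : ∀ x, IsClosed (S x) := fun x =>
    (hf.add (Continuous.lowerSemicontinuous (by fun_prop :
      Continuous fun u => ε * dist x u))).isClosed_preimage (f x)
  have hSb : ∀ x, BddBelow (f '' S x) := fun x => hb.mono (image_subset_range f _)
  have hstep : ∀ (x : α) (n : ℕ), ∃ y ∈ S x, ∀ z ∈ S x, f y ≤ f z + (1 / 2) ^ n := by
    intro x n
    obtain ⟨_, ⟨y, hy, rfl⟩, hlt⟩ := Real.lt_sInf_add_pos (s := f '' S x)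
      ⟨_, mem_image_of_mem f (hSself x)⟩ (by positivity : (0 : ℝ) < (1 / 2) ^ n)
    exact ⟨y, hy, fun z hz =>
      hlt.le.trans (by gcongr; exact csInf_le (hSb x) (mem_image_of_mem f hz))⟩
  choose next hnext hmin using hstep
  obtain ⟨_, ⟨x₀, rfl⟩, hx₀⟩ := Real.lt_sInf_add_pos (range_nonempty f) hε
  let x : ℕ → α := fun n => Nat.rec x₀ (fun n y => next y n) n
  have hx_succ : ∀ n, x (n + 1) = next (x n) n := fun n => rfl
  have hx_mem : ∀ n m, n ≤ m → x m ∈ S (x n) := by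
    intro n m h
    induction m, h using Nat.le_induction with
    | base => exact hSself _
    | succ m _ ih => exact hStrans ih (hx_succ m ▸ hnext _ _)
  have hpow : Tendsto (fun n : ℕ => ((1 : ℝ) / 2) ^ n) atTop (𝓝 0) :=
    tendsto_pow_atTop_nhds_zero_of_lt_one (by norm_num) (by norm_num)
  have hx_dist : ∀ n, ∀ z ∈ S (x (n + 1)), dist (x (n + 1)) z ≤ (1 / 2) ^ n / ε := by
    intro n z hz
    have h := hmin (x n) n z (hStrans (hx_mem n (n + 1) n.le_succ) hz)
    rw [← hx_succ] at h
    simp only [S, mem_ofPred_eq] at hz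
    rw [le_div_iff₀ hε]
    linarith
  have hcauchy : CauchySeq fun n => x (n + 1) :=
    cauchySeq_of_le_tendsto_0' (fun n => (1 / 2) ^ n / ε)
      (fun n m h => hx_dist n _ (hx_mem (n + 1) (m + 1) (by omega))) (by simpa using hpow.div_const ε)
  obtain ⟨y, hy⟩ := cauchySeq_tendsto_of_complete hcauchy
  have hy_mem : ∀ n, y ∈ S (x n) := fun n =>
    (hSclosed (x n)).mem_of_tendsto hy
      ((eventually_ge_atTop n).mono fun m hm => hx_mem n (m + 1) (by omega))
  have hfy : ∀ n, f y ≤ f (x n) := fun n => by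
    have h := hy_mem n
    simp only [S, mem_ofPred_eq] at h
    nlinarith [mul_nonneg hε.le (dist_nonneg (x := x n) (y := y))]
  refine ⟨y, (hfy 0).trans hx₀.le, fun u => ?_⟩
  by_contra! hu
  have huy : u ∈ S y := hu.le
  have hle : f y ≤ f u := by
    refine ge_of_tendsto' (add_zero (f u) ▸ hpow.const_add (f u)) fun n => ?_
    exact (hfy (n + 1)).trans (hmin (x n) n u (hStrans (hy_mem n) huy))
  nlinarith [mul_nonneg hε.le (dist_nonneg (x := y) (y := u))]

section PeakSelection

variable {X : Type*} [NormedAddCommGroup X] [InnerProductSpace ℝ X] {L : Submodule ℝ X}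

theorem smul_add_mem_halfspaceCone {v w : X} {t : ℝ} (ht : 0 ≤ t) (hw : w ∈ L) :
    t • v + w ∈ halfspaceCone L v :=
  ⟨t, ht, w, hw, rfl⟩

/-- At a local maximum on `[L, v]` with positive `v`-coefficient, the derivative vanishes on
the span of `L` and `v`. -/
theorem IsLocalMaxOn.fderiv_halfspaceCone_eq_zero {E : X → ℝ} {v w y : X} {t a : ℝ}
    (hmax : IsLocalMaxOn E (halfspaceCone L v) (t • v + w))
    (hE : DifferentiableAt ℝ E (t • v + w)) (ht : 0 < t) (hw : w ∈ L) (hy : y ∈ L) :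
    fderiv ℝ E (t • v + w) (a • v + y) = 0 := by
  set x := t • v + w with hx
  set d := a • v + y with hd
  have hline : HasDerivAt (fun s : ℝ => x + s • d) d 0 := by
    simpa using ((hasDerivAt_id (0 : ℝ)).smul_const d).const_add x
  have hder : HasDerivAt (fun s : ℝ => E (x + s • d)) (fderiv ℝ E x d) 0 :=
    HasFDerivAt.comp_hasDerivAt (0 : ℝ) (by simpa using hE.hasFDerivAt) hline
  refine IsLocalMax.hasDerivAt_eq_zero ?_ hder
  have hpos : ∀ᶠ s : ℝ in 𝓝 0, 0 ≤ t + s * a := by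
    have : Tendsto (fun s : ℝ => t + s * a) (𝓝 0) (𝓝 t) :=
      (by fun_prop : Continuous fun s : ℝ => t + s * a).tendsto' _ _ (by simp)
    exact (this.eventually_const_lt ht).mono fun _ => le_of_lt
  have htend : Tendsto (fun s : ℝ => x + s • d) (𝓝 0) (𝓝[halfspaceCone L v] x) := by
    refine tendsto_nhdsWithin_iff.2 ⟨by simpa using hline.continuousAt.tendsto, ?_⟩
    filter_upwards [hpos] with s hs
    have : x + s • d = (t + s * a) • v + (w + s • y) := by rw [hx, hd]; module
    rw [this]
    exact smul_add_mem_halfspaceCone hs (L.add_mem hw (L.smul_mem s hy))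
  simpa [IsLocalMax, IsMaxFilter] using htend.eventually hmax

theorem norm_sq_orthogonal_add_smul {v0L w : X} {τ : ℝ} (hv0L : v0L ∈ L) (hw : w ∈ Lᗮ) :
    ‖w + τ • v0L‖ ^ 2 = ‖w‖ ^ 2 + τ ^ 2 * ‖v0L‖ ^ 2 := by
  have h : inner ℝ w (τ • v0L) = 0 :=
    Submodule.inner_left_of_mem_orthogonal (L.smul_mem τ hv0L) hw
  have := norm_add_sq_eq_norm_sq_add_norm_sq_real h
  rw [norm_smul, Real.norm_eq_abs] at this
  nlinarith [sq_abs τ]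

/-- Moving `v ∈ V₀` in a direction orthogonal to both `L` and `v` and renormalizing stays
in `V₀`. -/
theorem inv_norm_smul_sub_mem_V0 {v0L v g : X} (hv : v ∈ V0 L v0L) (hg : g ∈ Lᗮ)
    (hN : 1 ≤ ‖v - g‖) : ‖v - g‖⁻¹ • (v - g) ∈ V0 L v0L := by
  obtain ⟨-, w, hw, τ, h0, h1, hvw⟩ := hv
  have hN0 : 0 < ‖v - g‖ := by linarith
  refine ⟨?_, ‖v - g‖⁻¹ • (w - g), Submodule.smul_mem _ _ (Submodule.sub_mem _ hw hg),
    ‖v - g‖⁻¹ * τ, by positivity, ?_, ?_⟩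
  · rw [norm_smul, norm_inv, norm_norm, inv_mul_cancel₀ hN0.ne']
  · exact mul_le_one₀ (inv_le_one_of_one_le₀ hN) h0 h1
  · nth_rw 2 [hvw]
    module

variable [L.HasOrthogonalProjection]

theorem starProjection_orthogonal_add {x y : X} (hx : x ∈ Lᗮ) (hy : y ∈ L) :
    Lᗮ.starProjection (x + y) = x := by
  rw [map_add, Submodule.starProjection_eq_self_iff.2 hx,
    Submodule.starProjection_orthogonal_apply_eq_zero hy, add_zero]

theorem norm_le_norm_starProjection_of_mem_V0 {v0perp v0L v : X} (hv0perp : v0perp ∈ Lᗮ)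
    (hv0L : v0L ∈ L) (hv0 : ‖v0perp + v0L‖ = 1) (hv : v ∈ V0 L v0L) :
    ‖v0perp‖ ≤ ‖Lᗮ.starProjection v‖ := by
  obtain ⟨hnorm, w, hw, τ, h0, h1, rfl⟩ := hv
  rw [starProjection_orthogonal_add hw (L.smul_mem τ hv0L)]
  have e₁ := norm_sq_orthogonal_add_smul (τ := τ) hv0L hw
  have e₂ := norm_sq_orthogonal_add_smul (τ := 1) hv0L hv0perp
  rw [one_smul, hv0] at e₂
  rw [hnorm] at e₁
  have : τ ^ 2 ≤ 1 := by nlinarith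
  refine abs_le_of_sq_le_sq' ?_ (norm_nonneg w) |>.2
  nlinarith [mul_le_mul_of_nonneg_right this (sq_nonneg ‖v0L‖)]

theorem isClosed_V0 {v0L : X} (hv0L : v0L ∈ L) : IsClosed (V0 L v0L) := by
  have h : V0 L v0L = {v | ‖v‖ = 1} ∩
      (fun v => v - Lᗮ.starProjection v) ⁻¹' ((fun τ : ℝ => τ • v0L) '' Icc 0 1) := by
    ext v
    constructor
    · rintro ⟨hnorm, w, hw, τ, h0, h1, rfl⟩
      refine ⟨hnorm, τ, ⟨h0, h1⟩, ?_⟩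
      simp [starProjection_orthogonal_add hw (L.smul_mem τ hv0L)]
    · rintro ⟨hnorm, τ, ⟨h0, h1⟩, hτ⟩
      exact ⟨hnorm, _, Submodule.starProjection_apply_mem _ v, τ, h0, h1, by
        simp only at hτ; rw [hτ]; abel⟩
  rw [h]
  exact (isClosed_eq continuous_norm continuous_const).inter
    (((isCompact_Icc.image (by fun_prop)).isClosed).preimage (by fun_prop))

/-- Quantitative descent: if moving `v` within `V₀` cannot decrease `E ∘ p` at rate more
than `ε`, then the derivative of `E` at the peak point `p v` is of order `ε`. -/
theorem mul_norm_fderiv_le_of_forall_le_add [CompleteSpace X] {E : X → ℝ} (hE : ContDiff ℝ 1 E)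
    {v0perp v0L : X} (hv0perp : v0perp ∈ Lᗮ) (hv0perp0 : v0perp ≠ 0) (hv0L : v0L ∈ L)
    (hv0 : ‖v0perp + v0L‖ = 1) {p : X → X}
    (hpsel : ∀ v ∈ V0 L v0L, IsLocalMaxOn E (halfspaceCone L v) (p v))
    {t : X → ℝ} {wL : X → X}
    (hdecomp : ∀ v ∈ V0 L v0L, p v = t v • v + wL v ∧ wL v ∈ L)
    (hpc : ContinuousOn p (V0 L v0L))
    {δ : ℝ} (hδ : 0 < δ) (ht : ∀ v ∈ V0 L v0L, δ ≤ t v)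
    {v : X} (hv : v ∈ V0 L v0L) {ε : ℝ} (hε : 0 < ε)
    (hmin : ∀ u ∈ V0 L v0L, E (p v) ≤ E (p u) + ε * ‖u - v‖) :
    δ * ‖fderiv ℝ E (p v)‖ ≤ 8 * ε := by
  set g := (InnerProductSpace.toDual ℝ X).symm (fderiv ℝ E (p v)) with hg
  have hgE : ∀ y, fderiv ℝ E (p v) y = inner ℝ g y := fun y => by
    rw [hg, InnerProductSpace.toDual_symm_apply]
  have hgn : ‖fderiv ℝ E (p v)‖ = ‖g‖ := by rw [hg, LinearIsometryEquiv.norm_map]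
  rw [hgn]
  rcases eq_or_ne g 0 with h0 | hg0
  · rw [h0, norm_zero]; linarith
  have hgpos : 0 < ‖g‖ := norm_pos_iff.2 hg0
  have hcrit : ∀ (a : ℝ), ∀ y ∈ L, inner ℝ g (a • v + y) = 0 := by
    intro a y hy
    obtain ⟨hpv, hw⟩ := hdecomp v hv
    have hmax := hpsel v hv
    rw [← hgE]
    rw [hpv] at hmax ⊢
    exact hmax.fderiv_halfspaceCone_eq_zero (hE.differentiable (by norm_num) _)
      (hδ.trans_le (ht v hv)) hw hy
  have hgL : g ∈ Lᗮ := (Submodule.mem_orthogonal' _ _).2 fun y hy => by simpa using hcrit 0 y hy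
  have hgv : inner ℝ g v = 0 := by simpa using hcrit 1 0 L.zero_mem
  have hvn : ‖v‖ = 1 := hv.1
  let N : ℝ → ℝ := fun s => ‖v - s • g‖
  have hN1 : ∀ s, 1 ≤ N s := by
    intro s
    have h : inner ℝ v (s • g) = 0 := by
      rw [inner_smul_right, real_inner_comm, hgv, mul_zero]
    have := norm_sub_sq_eq_norm_sq_add_norm_sq_real h
    rw [hvn] at this
    change 1 ≤ ‖v - s • g‖
    nlinarith [norm_nonneg (v - s • g), norm_nonneg (s • g)]
  let c : ℝ → X := fun s => (N s)⁻¹ • (v - s • g)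
  have hcV : ∀ s, c s ∈ V0 L v0L := fun s =>
    inv_norm_smul_sub_mem_V0 hv (Submodule.smul_mem _ s hgL) (hN1 s)
  have hN_le : ∀ s, 0 ≤ s → N s ≤ 1 + s * ‖g‖ := by
    intro s hs
    have := norm_sub_le v (s • g)
    rwa [hvn, norm_smul, Real.norm_of_nonneg hs] at this
  have hc_dist : ∀ s, 0 ≤ s → ‖c s - v‖ ≤ 2 * (s * ‖g‖) := by
    intro s hs
    have hNs : N s ≠ 0 := (zero_lt_one.trans_le (hN1 s)).ne'
    have e : c s - v = -((N s - 1) • c s) - s • g := by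
      have : N s • c s = v - s • g := smul_inv_smul₀ hNs _
      rw [sub_smul, this, one_smul]
      abel
    calc ‖c s - v‖ ≤ ‖(N s - 1) • c s‖ + ‖s • g‖ := by
          rw [e]; simpa using norm_sub_le (-((N s - 1) • c s)) (s • g)
      _ = (N s - 1) + s * ‖g‖ := by
          rw [norm_smul (N s - 1) (c s), norm_smul s g, (hcV s).1, Real.norm_of_nonneg hs,
            Real.norm_of_nonneg (sub_nonneg.2 (hN1 s)), mul_one]
      _ ≤ 2 * (s * ‖g‖) := by linarith [hN_le s hs]
  have hs0 : Tendsto (fun s : ℝ => s) (𝓝[>] 0) (𝓝 0) := tendsto_nhdsWithin_of_tendsto_nhds tendsto_id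
  have hct : Tendsto c (𝓝[>] 0) (𝓝 v) := by
    refine tendsto_iff_norm_sub_tendsto_zero.2 (squeeze_zero' (.of_forall fun _ => norm_nonneg _)
      (g := fun s => 2 * (s * ‖g‖)) ?_ (by simpa using (hs0.mul_const ‖g‖).const_mul 2))
    filter_upwards [self_mem_nhdsWithin] with s hs using hc_dist s (le_of_lt hs)
  have hpt : Tendsto (fun s => p (c s)) (𝓝[>] 0) (𝓝 (p v)) :=
    (hpc v hv).tendsto.comp (tendsto_nhdsWithin_iff.2 ⟨hct, .of_forall hcV⟩)
  let a : ℝ → ℝ := fun s => t (c s) * (N s)⁻¹ * s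
  let y : ℝ → X := fun s => p (c s) + a s • g
  have htpos : ∀ s, 0 < t (c s) := fun s => hδ.trans_le (ht _ (hcV s))
  have hyt : Tendsto y (𝓝[>] 0) (𝓝 (p v)) := by
    have hat : Tendsto a (𝓝[>] 0) (𝓝 0) := by
      have hb : Tendsto (fun s => ‖p (c s)‖ / ‖v0perp‖ * s) (𝓝[>] 0) (𝓝 0) := by
        simpa using (hpt.norm.div_const ‖v0perp‖).mul hs0
      refine squeeze_zero' ?_ ?_ hb
      · filter_upwards [self_mem_nhdsWithin] with s hs
        have hs : 0 < s := hs
        have := htpos s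
        have := hN1 s
        positivity
      · filter_upwards [self_mem_nhdsWithin] with s hs
        refine mul_le_mul_of_nonneg_right ?_ (le_of_lt hs)
        refine (mul_le_of_le_one_right (htpos s).le (inv_le_one_of_one_le₀ (hN1 s))).trans ?_
        rw [le_div_iff₀ (norm_pos_iff.2 hv0perp0)]
        obtain ⟨hpv, hw⟩ := hdecomp _ (hcV s)
        calc t (c s) * ‖v0perp‖ ≤ t (c s) * ‖Lᗮ.starProjection (c s)‖ :=
              mul_le_mul_of_nonneg_left
                (norm_le_norm_starProjection_of_mem_V0 hv0perp hv0L hv0 (hcV s)) (htpos s).le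
          _ = ‖Lᗮ.starProjection (p (c s))‖ := by
              rw [hpv, map_add, Submodule.starProjection_orthogonal_apply_eq_zero hw, add_zero,
                map_smul _ (t (c s)), norm_smul (t (c s)), Real.norm_of_nonneg (htpos s).le]
          _ ≤ ‖p (c s)‖ := Submodule.norm_starProjection_apply_le _ _
    simpa [y] using hpt.add (hat.smul_const g)
  have hycone : ∀ s, y s ∈ halfspaceCone L v := by
    intro s
    obtain ⟨hpv, hw⟩ := hdecomp _ (hcV s)
    have e : y s = (t (c s) * (N s)⁻¹) • v + wL (c s) := by
      simp only [y, a]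
      nth_rw 1 [hpv]
      simp only [c]
      module
    rw [e]
    exact smul_add_mem_halfspaceCone
      (mul_nonneg (htpos s).le (inv_nonneg.2 (zero_le_one.trans (hN1 s)))) hw
  have hEy : ∀ᶠ s in 𝓝[>] 0, E (y s) ≤ E (p v) :=
    (tendsto_nhdsWithin_iff.2 ⟨hyt, .of_forall hycone⟩).eventually (hpsel v hv)
  have hstrict : ∀ᶠ s in 𝓝[>] (0 : ℝ), ‖E (p (c s)) - E (y s) - fderiv ℝ E (p v) (p (c s) - y s)‖ ≤
      ‖g‖ / 2 * ‖p (c s) - y s‖ :=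
    (hpt.prodMk_nhds hyt).eventually
      (((hE.contDiffAt.hasStrictFDerivAt (by norm_num)).isLittleO).def (half_pos hgpos))
  have hsmall : ∀ᶠ s : ℝ in 𝓝[>] 0, s * ‖g‖ < 1 :=
    (show Tendsto (fun s : ℝ => s * ‖g‖) (𝓝[>] 0) (𝓝 0) by
      simpa using hs0.mul_const ‖g‖).eventually_lt_const one_pos
  obtain ⟨s, hs, hEys, hst, hsm⟩ :=
    (eventually_mem_nhdsWithin.and (hEy.and (hstrict.and hsmall))).exists
  have hs : 0 < s := hs
  have hN2 : N s ≤ 2 := by linarith [hN_le s hs.le]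
  have hNpos : 0 < N s := zero_lt_one.trans_le (hN1 s)
  have ha : δ / 2 * s ≤ a s := by
    refine mul_le_mul_of_nonneg_right ?_ hs.le
    rw [← div_eq_mul_inv]
    exact div_le_div₀ (htpos s).le (ht _ (hcV s)) hNpos hN2
  have ha0 : 0 ≤ a s := le_trans (by positivity) ha
  have hdiff : p (c s) - y s = -(a s • g) := by simp [y]
  rw [hdiff, norm_neg, norm_smul, Real.norm_of_nonneg ha0, map_neg, hgE, inner_smul_right,
    real_inner_self_eq_norm_sq, Real.norm_eq_abs] at hst
  have h₁ := (abs_le.1 hst).2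
  have h₂ := hmin _ (hcV s)
  have h₃ := mul_le_mul_of_nonneg_left (hc_dist s hs.le) hε.le
  have h₄ : a s * (‖g‖ ^ 2 / 2) ≤ ε * (2 * (s * ‖g‖)) := by nlinarith
  have h₅ := mul_le_mul_of_nonneg_right ha (by positivity : 0 ≤ ‖g‖ ^ 2 / 2)
  have h₆ : (s * ‖g‖) * (δ * ‖g‖) ≤ (s * ‖g‖) * (8 * ε) := by nlinarith
  exact le_of_mul_le_mul_left h₆ (by positivity)

/-- Properness of the peak map: convergence of the values `p (v n)` with coefficients bounded
away from zero yields a convergent subsequence of `v n`. -/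
theorem exists_tendsto_subseq_of_tendsto_peak {v0perp v0L : X} (hv0perp : v0perp ∈ Lᗮ)
    (hv0perp0 : v0perp ≠ 0) (hv0L : v0L ∈ L) (hv0 : ‖v0perp + v0L‖ = 1)
    {δ : ℝ} (hδ : 0 < δ) {v w : ℕ → X} {t : ℕ → ℝ} (hv : ∀ n, v n ∈ V0 L v0L)
    (hw : ∀ n, w n ∈ L) (ht : ∀ n, δ ≤ t n) {u : X}
    (hu : Tendsto (fun n => t n • v n + w n) atTop (𝓝 u)) :
    ∃ z ∈ V0 L v0L, ∃ φ : ℕ → ℕ, StrictMono φ ∧ Tendsto (v ∘ φ) atTop (𝓝 z) := by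
  set P := Lᗮ.starProjection
  have hdec : ∀ n, ∃ τ ∈ Icc (0 : ℝ) 1, v n = P (v n) + τ • v0L := by
    intro n
    obtain ⟨-, x, hx, τ, h0, h1, h⟩ := hv n
    refine ⟨τ, ⟨h0, h1⟩, ?_⟩
    rw [h, starProjection_orthogonal_add hx (L.smul_mem τ hv0L)]
  choose τ hτ hvτ using hdec
  have hr : ∀ n, ‖P (v n)‖ ∈ Icc (0 : ℝ) 1 := fun n =>
    ⟨norm_nonneg _, (Submodule.norm_starProjection_apply_le _ _).trans_eq (hv n).1⟩
  obtain ⟨⟨τ', r⟩, -, φ, hφ, hlim⟩ := (isCompact_Icc.prod isCompact_Icc).tendsto_subseq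
    (x := fun n => (τ n, ‖P (v n)‖)) fun n => ⟨hτ n, hr n⟩
  have hτlim : Tendsto (fun n => τ (φ n)) atTop (𝓝 τ') := hlim.fst_nhds
  have hrlim : Tendsto (fun n => ‖P (v (φ n))‖) atTop (𝓝 r) := hlim.snd_nhds
  have hP : ∀ n, P (t n • v n + w n) = t n • P (v n) := fun n => by
    rw [map_add, map_smul, Submodule.starProjection_orthogonal_apply_eq_zero (hw n), add_zero]
  have hPu : Tendsto (fun n => t n • P (v n)) atTop (𝓝 (P u)) := by
    simpa only [Function.comp_def, hP] using (P.continuous.tendsto u).comp hu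
  have hc : 0 < ‖v0perp‖ := norm_pos_iff.2 hv0perp0
  have hPv : ∀ n, ‖v0perp‖ ≤ ‖P (v n)‖ := fun n =>
    norm_le_norm_starProjection_of_mem_V0 hv0perp hv0L hv0 (hv n)
  have hPu0 : ‖P u‖ ≠ 0 := by
    have : δ * ‖v0perp‖ ≤ ‖P u‖ := by
      refine ge_of_tendsto' hPu.norm fun n => ?_
      rw [norm_smul, Real.norm_of_nonneg (hδ.le.trans (ht n))]
      exact mul_le_mul (ht n) (hPv n) hc.le (hδ.le.trans (ht n))
    exact ((mul_pos hδ hc).trans_le this).ne'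
  have hPu' := hPu.comp hφ.tendsto_atTop
  have hlimv : Tendsto (v ∘ φ) atTop (𝓝 ((r * ‖P u‖⁻¹) • P u + τ' • v0L)) := by
    refine (((hrlim.mul (hPu'.norm.inv₀ hPu0)).smul hPu').add
      (hτlim.smul_const v0L)).congr fun n => ?_
    have htn : 0 < t (φ n) := hδ.trans_le (ht _)
    have hrn : ‖P (v (φ n))‖ ≠ 0 := (hc.trans_le (hPv _)).ne'
    simp only [Function.comp_apply]
    nth_rw 4 [hvτ (φ n)]
    rw [norm_smul, Real.norm_of_nonneg htn.le, smul_smul]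
    congr 1
    convert one_smul ℝ (P (v (φ n))) using 2
    field_simp
  exact ⟨_, (isClosed_V0 hv0L).mem_of_tendsto hlimv (.of_forall fun n => hv _), φ, hφ, hlimv⟩

end PeakSelection

/-- Theorem 2.7, existence: if `E ∈ C¹` satisfies the (PS) condition and
has a peak selection `p` w.r.t. `L` on `V₀` which is continuous on `V₀`, with `t_v ≥ δ > 0`
on `V₀` and `inf_{v ∈ V₀} E(p(v)) > −∞`, then there is `v_* ∈ V₀` such that `p(v_*) ∉ L`
is a critical point attaining the infimum. -/
theorem statement5
    {X : Type*} [NormedAddCommGroup X] [InnerProductSpace ℝ X] [CompleteSpace X]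
    (E : X → ℝ) (hE : ContDiff ℝ 1 E)
    (hPS : ∀ w : ℕ → X, (∃ b : ℝ, ∀ j, |E (w j)| ≤ b) →
      Tendsto (fun j => ‖fderiv ℝ E (w j)‖) atTop (nhds 0) →
      ∃ (u : X) (φ : ℕ → ℕ), StrictMono φ ∧ Tendsto (w ∘ φ) atTop (nhds u))
    (L : Submodule ℝ X) [FiniteDimensional ℝ L]
    (v0perp v0L : X) (hv0perp : v0perp ∈ Lᗮ) (hv0perp0 : v0perp ≠ 0) (hv0L : v0L ∈ L)
    (hv0 : ‖v0perp + v0L‖ = 1)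
    (p : X → X)
    (hpsel : ∀ v ∈ V0 L v0L, p v ∈ halfspaceCone L v ∧ IsLocalMaxOn E (halfspaceCone L v) (p v))
    (t : X → ℝ) (wL : X → X)
    (hdecomp : ∀ v ∈ V0 L v0L, p v = t v • v + wL v ∧ wL v ∈ L)
    (hpc : ContinuousOn p (V0 L v0L))
    (δ : ℝ) (hδ : 0 < δ) (ht : ∀ v ∈ V0 L v0L, δ ≤ t v)
    (hbdd : BddBelow ((fun v => E (p v)) '' V0 L v0L)) :
    ∃ vstar ∈ V0 L v0L, p vstar ∉ L ∧ fderiv ℝ E (p vstar) = 0 ∧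
      E (p vstar) = sInf ((fun v => E (p v)) '' V0 L v0L) := by
  set V := V0 L v0L
  have hVne : v0perp + v0L ∈ V :=
    ⟨hv0, v0perp, hv0perp, 1, zero_le_one, le_rfl, by rw [one_smul]⟩
  have : CompleteSpace V := (isClosed_V0 hv0L).completeSpace_coe
  have : Nonempty V := ⟨⟨_, hVne⟩⟩
  let J : V → ℝ := fun v => E (p v)
  have hJ : Continuous J := hE.continuous.comp hpc.domRestrict
  have hrange : range J = (fun v => E (p v)) '' V := (image_eq_range (fun v => E (p v)) V).symm
  set m := sInf ((fun v => E (p v)) '' V) with hm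
  have hJb : BddBelow (range J) := hrange ▸ hbdd
  have hε : ∀ n : ℕ, (0 : ℝ) < 1 / (n + 1) := fun n => by positivity
  choose v hvle hvmin using fun n : ℕ =>
    exists_forall_le_add_mul_dist hJ.lowerSemicontinuous hJb (hε n)
  rw [hrange, ← hm] at hvle
  have hm_le : ∀ x : V, m ≤ J x := fun x => csInf_le hbdd ⟨x, x.2, rfl⟩
  have hεlim : Tendsto (fun n : ℕ => (1 : ℝ) / (n + 1)) atTop (𝓝 0) :=
    tendsto_one_div_add_atTop_nhds_zero_nat
  have hJlim : Tendsto (fun n => E (p (v n))) atTop (𝓝 m) :=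
    tendsto_of_tendsto_of_tendsto_of_le_of_le tendsto_const_nhds
      (by simpa using hεlim.const_add m) (fun n => hm_le _) hvle
  have hderiv : ∀ n, ‖fderiv ℝ E (p (v n))‖ ≤ 8 * (1 / ((n : ℝ) + 1)) / δ := by
    intro n
    rw [le_div_iff₀' hδ]
    refine mul_norm_fderiv_le_of_forall_le_add hE hv0perp hv0perp0 hv0L hv0
      (fun x hx => (hpsel x hx).2) hdecomp hpc hδ ht (v n).2 (hε n) fun x hx => ?_
    simpa [J, Subtype.dist_eq, dist_eq_norm, norm_sub_rev] using hvmin n ⟨x, hx⟩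
  have hderiv0 : Tendsto (fun n => ‖fderiv ℝ E (p (v n))‖) atTop (𝓝 0) :=
    squeeze_zero (fun _ => norm_nonneg _) hderiv (by simpa using (hεlim.const_mul 8).div_const δ)
  have hbound : ∃ b : ℝ, ∀ n, |E (p (v n))| ≤ b := by
    obtain ⟨b, hb⟩ := hJlim.abs.bddAbove_range
    exact ⟨b, fun n => hb ⟨n, rfl⟩⟩
  obtain ⟨u, φ, hφ, hu⟩ := hPS (fun n => p (v n)) hbound hderiv0
  obtain ⟨z, hz, ψ, hψ, hvz⟩ := exists_tendsto_subseq_of_tendsto_peak hv0perp hv0perp0 hv0L hv0 hδ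
    (fun n => (v (φ n)).2) (fun n => (hdecomp _ (v (φ n)).2).2) (fun n => ht _ (v (φ n)).2)
    (hu.congr fun n => (hdecomp _ (v (φ n)).2).1)
  have hsub : Tendsto (φ ∘ ψ) atTop atTop := (hφ.comp hψ).tendsto_atTop
  have hpz : Tendsto (fun n => p (v (φ (ψ n)))) atTop (𝓝 (p z)) :=
    (hpc z hz).tendsto.comp (tendsto_nhdsWithin_iff.2 ⟨hvz, .of_forall fun n => (v _).2⟩)
  refine ⟨z, hz, fun hpL => ?_, ?_, ?_⟩
  · obtain ⟨hpz', hwz⟩ := hdecomp z hz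
    have htz : 0 < t z := hδ.trans_le (ht z hz)
    have hzL : z ∈ L := by
      rw [hpz', L.add_mem_iff_left hwz, L.smul_mem_iff htz.ne'] at hpL
      exact hpL
    have h := norm_le_norm_starProjection_of_mem_V0 hv0perp hv0L hv0 hz
    rw [Submodule.starProjection_orthogonal_apply_eq_zero hzL, norm_zero] at h
    exact hv0perp0 (norm_le_zero_iff.1 h)
  · have h₁ := (((hE.continuous_fderiv (by norm_num)).norm.tendsto (p z)).comp hpz)
    exact norm_eq_zero.1 (tendsto_nhds_unique h₁ (hderiv0.comp hsub))
  · exact tendsto_nhds_unique ((hE.continuous.tendsto (p z)).comp hpz) (hJlim.comp hsub)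
end
end

section
/- Suppose E ∈ C¹(X,ℝ), let p be a peak selection of E with respect to L, and let {v_k} be generated by the LMM iteration v_{k+1} = (v_k − α_k g_k)/‖v_k − α_k g_k‖ with α_k > 0, g_k = ∇E(p(v_k)), starting from v_0 ∈ S∖L. Write w_k = p(v_k) = t_k v_k + w_k^L with t_k ≥ 0 and w_k^L ∈ L. Assume (i) p is continuous on V_0 and (ii) t_k ≥ δ for some δ > 0 and all k. If {w_k} contains a subsequence {w_{k_i}} converging to some u_* ∈ X, then the corresponding subsequence {v_{k_i}} converges to some v_* ∈ V_0 satisfying u_* = p(v_*). -/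
open Filter Topology Set
open scoped RealInnerProductSpace ENNReal

noncomputable section

/-- At a local maximizer on `C`, the gradient is orthogonal to every direction along which a
two-sided segment stays in `C`. -/
theorem inner_gradient_eq_zero_of_isLocalMaxOn {X : Type*} [NormedAddCommGroup X]
    [InnerProductSpace ℝ X] [CompleteSpace X] {E : X → ℝ} {C : Set X} {x d : X}
    (hE : DifferentiableAt ℝ E x) (hmax : IsLocalMaxOn E C x)
    (hC : ∀ᶠ s : ℝ in 𝓝 0, x + s • d ∈ C) : ⟪gradient E x, d⟫ = 0 := by
  have hline : HasDerivAt (fun s : ℝ => x + s • d) d 0 := by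
    simpa using ((hasDerivAt_id (0 : ℝ)).smul_const d).const_add x
  have hgrad : HasFDerivAt E (InnerProductSpace.toDual ℝ X (gradient E x)) (x + (0 : ℝ) • d) := by
    simpa using hE.hasGradientAt.hasFDerivAt
  have hderiv := hgrad.comp_hasDerivAt (0 : ℝ) hline
  have htend : Tendsto (fun s : ℝ => x + s • d) (𝓝 0) (𝓝[C] x) := by
    refine tendsto_nhdsWithin_iff.2 ⟨?_, hC⟩
    simpa using hline.continuousAt.tendsto
  have hloc : IsLocalMax (E ∘ fun s : ℝ => x + s • d) 0 := by
    filter_upwards [htend.eventually hmax] with s hs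
    simpa using hs
  simpa using hloc.hasDerivAt_eq_zero hderiv

/-- At a local maximizer on `[L, v]`, the gradient is orthogonal to `L`. -/
theorem gradient_mem_orthogonal {X : Type*} [NormedAddCommGroup X] [InnerProductSpace ℝ X]
    [CompleteSpace X] {E : X → ℝ} {L : Submodule ℝ X} {v x : X}
    (hE : DifferentiableAt ℝ E x) (hx : x ∈ halfspaceCone L v)
    (hmax : IsLocalMaxOn E (halfspaceCone L v) x) : gradient E x ∈ Lᗮ := by
  obtain ⟨t, ht, w, hw, rfl⟩ := hx
  refine (Submodule.mem_orthogonal' _ _).2 fun d hd =>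
    inner_gradient_eq_zero_of_isLocalMaxOn hE hmax (Eventually.of_forall fun s => ?_)
  exact ⟨t, ht, w + s • d, L.add_mem hw (L.smul_mem s hd), by abel⟩

/-- At a local maximizer `t • v + w` on `[L, v]` with `t > 0`, the gradient is orthogonal
to `v`. -/
theorem inner_gradient_self_eq_zero {X : Type*} [NormedAddCommGroup X] [InnerProductSpace ℝ X]
    [CompleteSpace X] {E : X → ℝ} {L : Submodule ℝ X} {v w : X} {t : ℝ} (ht : 0 < t)
    (hw : w ∈ L) (hE : DifferentiableAt ℝ E (t • v + w))
    (hmax : IsLocalMaxOn E (halfspaceCone L v) (t • v + w)) :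
    ⟪gradient E (t • v + w), v⟫ = 0 := by
  refine inner_gradient_eq_zero_of_isLocalMaxOn hE hmax ?_
  filter_upwards [lt_mem_nhds (neg_lt_zero.2 ht)] with s hs
  exact ⟨t + s, by linarith, w, hw, by rw [add_smul]; abel⟩

/-- The normalizing factor of a step orthogonal to a unit vector is at least one. -/
theorem one_le_norm_sub_smul {X : Type*} [NormedAddCommGroup X] [InnerProductSpace ℝ X]
    {v g : X} (hv : ‖v‖ = 1) (hgv : ⟪g, v⟫ = 0) (a : ℝ) : 1 ≤ ‖v - a • g‖ := by
  have h := norm_sub_sq_real v (a • g)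
  rw [real_inner_smul_right, real_inner_comm, hgv, hv] at h
  nlinarith [sq_nonneg ‖a • g‖, norm_nonneg (v - a • g)]

/-- Convergence of positive multiples of the `Lᗮ`-components of unit vectors forces convergence
of the unit vectors, when their `L`-components converge to a vector of norm less than one. -/
theorem exists_tendsto_of_tendsto_smul {X : Type*} [NormedAddCommGroup X] [InnerProductSpace ℝ X]
    {L : Submodule ℝ X} {v0L : X} (hv0L : v0L ∈ L) {z : ℕ → X} {t τ : ℕ → ℝ} {δ σ : ℝ} {u : X}
    (hδ : 0 < δ) (ht : ∀ i, δ ≤ t i) (hz : ∀ i, z i ∈ Lᗮ)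
    (hnorm : ∀ i, ‖z i + τ i • v0L‖ = 1) (hτ : Tendsto τ atTop (𝓝 σ))
    (hσ : σ ^ 2 * ‖v0L‖ ^ 2 < 1) (hu : Tendsto (fun i => t i • z i) atTop (𝓝 u)) :
    ∃ ζ ∈ Lᗮ, Tendsto z atTop (𝓝 ζ) := by
  have hsq : ∀ i, ‖z i‖ = √(1 - τ i ^ 2 * ‖v0L‖ ^ 2) := fun i => by
    have h := norm_add_sq_real (z i) (τ i • v0L)
    rw [Submodule.inner_left_of_mem_orthogonal (L.smul_mem _ hv0L) (hz i), hnorm i, norm_smul,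
      mul_pow, Real.norm_eq_abs, sq_abs] at h
    rw [← Real.sqrt_sq (norm_nonneg (z i))]
    congr 1
    linarith
  have hc : 0 < √(1 - σ ^ 2 * ‖v0L‖ ^ 2) := Real.sqrt_pos.2 (by linarith)
  have hznorm : Tendsto (fun i => ‖z i‖) atTop (𝓝 √(1 - σ ^ 2 * ‖v0L‖ ^ 2)) := by
    simp only [hsq]
    exact (((hτ.pow 2).mul_const _).const_sub 1).sqrt
  have htlim : Tendsto t atTop (𝓝 (‖u‖ / √(1 - σ ^ 2 * ‖v0L‖ ^ 2))) := by
    refine (hu.norm.div hznorm hc.ne').congr' ?_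
    filter_upwards [hznorm.eventually_ne hc.ne'] with i hi
    rw [Pi.div_apply, norm_smul, Real.norm_of_nonneg (hδ.le.trans (ht i)),
      mul_div_cancel_right₀ _ hi]
  have hpos := hδ.trans_le (ge_of_tendsto' htlim ht)
  have hzlim := ((htlim.inv₀ hpos.ne').smul hu).congr fun i =>
    inv_smul_smul₀ (hδ.trans_le (ht i)).ne' (z i)
  exact ⟨_, L.isClosed_orthogonal.mem_of_tendsto hzlim (Eventually.of_forall hz), hzlim⟩

/-- Lemma 2.9, weak homeomorphism property: along the LMM iteration,
if `w_{k_i} = p(v_{k_i}) → u_*`, then `v_{k_i} → v_* ∈ V₀` with `u_* = p(v_*)`. -/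
theorem statement7
    {X : Type*} [NormedAddCommGroup X] [InnerProductSpace ℝ X] [CompleteSpace X]
    (E : X → ℝ) (hE : ContDiff ℝ 1 E)
    (L : Submodule ℝ X) [FiniteDimensional ℝ L]
    (v0perp v0L : X) (hv0perp : v0perp ∈ Lᗮ) (hv0perp0 : v0perp ≠ 0) (hv0L : v0L ∈ L)
    (hv0norm : ‖v0perp + v0L‖ = 1)
    (p : X → X)
    (hpsel : ∀ u : X, ‖u‖ = 1 →
      p u ∈ halfspaceCone L u ∧ IsLocalMaxOn E (halfspaceCone L u) (p u))
    (v : ℕ → X) (α : ℕ → ℝ)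
    (hα : ∀ k, 0 < α k)
    (hv00 : v 0 = v0perp + v0L)
    (hrec : ∀ k, v (k + 1) = stepv (v k) (gradient E (p (v k))) (α k))
    (t : ℕ → ℝ) (wL : ℕ → X)
    (hdecomp : ∀ k, p (v k) = t k • v k + wL k ∧ 0 ≤ t k ∧ wL k ∈ L)
    (hpc : ContinuousOn p (V0 L v0L))
    (δ : ℝ) (hδ : 0 < δ) (ht : ∀ k, δ ≤ t k)
    (ustar : X) (φ : ℕ → ℕ) (hφ : StrictMono φ)
    (hconv : Tendsto (fun i => p (v (φ i))) atTop (nhds ustar)) :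
    ∃ vstar ∈ V0 L v0L,
      Tendsto (fun i => v (φ i)) atTop (nhds vstar) ∧ ustar = p vstar := by
  have hdiff : Differentiable ℝ E := hE.differentiable one_ne_zero
  have hstep : ∀ k, ‖v k‖ = 1 → gradient E (p (v k)) ∈ Lᗮ ∧
      1 ≤ ‖v k - α k • gradient E (p (v k))‖ := fun k hk => by
    obtain ⟨hmem, hmax⟩ := hpsel (v k) hk
    refine ⟨gradient_mem_orthogonal (hdiff _) hmem hmax, one_le_norm_sub_smul hk ?_ _⟩
    obtain ⟨heq, -, hw⟩ := hdecomp k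
    rw [heq] at hmax ⊢
    exact inner_gradient_self_eq_zero (hδ.trans_le (ht k)) hw (hdiff _) hmax
  have hvnorm : ∀ k, ‖v k‖ = 1 := fun k => by
    induction k with
    | zero => rw [hv00, hv0norm]
    | succ k ih =>
      rw [hrec, stepv, norm_smul, norm_inv, norm_norm]
      exact inv_mul_cancel₀ (zero_lt_one.trans_le (hstep k ih).2).ne'
  let τ : ℕ → ℝ := fun k =>
    ∏ j ∈ Finset.range k, ‖v j - α j • gradient E (p (v j))‖⁻¹
  have hτsucc : ∀ k, τ (k + 1) = τ k * ‖v k - α k • gradient E (p (v k))‖⁻¹ := fun k =>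
    Finset.prod_range_succ _ _
  have hτ0 : ∀ k, 0 ≤ τ k := fun k =>
    Finset.prod_nonneg fun j _ => inv_nonneg.2 (norm_nonneg _)
  have hτanti : Antitone τ := antitone_nat_of_succ_le fun k => by
    rw [hτsucc]
    exact mul_le_of_le_one_right (hτ0 k) (inv_le_one_of_one_le₀ (hstep k (hvnorm k)).2)
  have hτ1 : ∀ k, τ k ≤ 1 := fun k => by simpa [τ] using hτanti (Nat.zero_le k)
  have hperp : ∀ k, v k - τ k • v0L ∈ Lᗮ := fun k => by
    induction k with
    | zero => simpa [τ, hv00] using hv0perp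
    | succ k ih =>
      have heq : v (k + 1) - τ (k + 1) • v0L = ‖v k - α k • gradient E (p (v k))‖⁻¹ •
          ((v k - τ k • v0L) - α k • gradient E (p (v k))) := by
        rw [hτsucc, hrec, stepv]
        module
      rw [heq]
      exact Lᗮ.smul_mem _ (Lᗮ.sub_mem ih (Lᗮ.smul_mem _ (hstep k (hvnorm k)).1))
  have hV0 : ∀ k, v k ∈ V0 L v0L := fun k =>
    ⟨hvnorm k, _, hperp k, τ k, hτ0 k, hτ1 k, (sub_add_cancel _ _).symm⟩
  have hτlim : Tendsto τ atTop (𝓝 (⨅ k, τ k)) :=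
    tendsto_atTop_ciInf hτanti ⟨0, by rintro _ ⟨k, rfl⟩; exact hτ0 k⟩
  have hσ0 := ge_of_tendsto' hτlim hτ0
  have hσ1 := le_of_tendsto' hτlim hτ1
  set σ := ⨅ k, τ k
  have hσ : σ ^ 2 * ‖v0L‖ ^ 2 < 1 := by
    have h := norm_add_sq_real v0perp v0L
    rw [Submodule.inner_left_of_mem_orthogonal hv0L hv0perp, hv0norm] at h
    have h0 : 0 < ‖v0perp‖ ^ 2 := pow_pos (norm_pos_iff.2 hv0perp0) 2
    have h1 : σ ^ 2 ≤ 1 := pow_le_one₀ hσ0 hσ1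
    nlinarith [sq_nonneg ‖v0L‖]
  have hproj : Tendsto (fun i => t (φ i) • (v (φ i) - τ (φ i) • v0L)) atTop
      (𝓝 (Lᗮ.starProjection ustar)) := by
    refine ((Lᗮ.starProjection.continuous.tendsto _).comp hconv).congr fun i => ?_
    obtain ⟨heq, -, hw⟩ := hdecomp (φ i)
    refine Submodule.eq_starProjection_of_mem_orthogonal (Lᗮ.smul_mem _ (hperp (φ i))) ?_
    refine L.le_orthogonal_orthogonal ?_
    have hsub : p (v (φ i)) - t (φ i) • (v (φ i) - τ (φ i) • v0L) =
        t (φ i) • τ (φ i) • v0L + wL (φ i) := by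
      rw [heq]
      module
    rw [hsub]
    exact L.add_mem (L.smul_mem _ (L.smul_mem _ hv0L)) hw
  have hτφ : Tendsto (fun i => τ (φ i)) atTop (𝓝 σ) := hτlim.comp hφ.tendsto_atTop
  obtain ⟨ζ, hζ, hzlim⟩ := exists_tendsto_of_tendsto_smul hv0L hδ (fun i => ht (φ i))
    (fun i => hperp (φ i)) (fun i => by rw [sub_add_cancel]; exact hvnorm (φ i)) hτφ hσ hproj
  have hvlim : Tendsto (fun i => v (φ i)) atTop (𝓝 (ζ + σ • v0L)) :=
    (hzlim.add (hτφ.smul_const v0L)).congr fun i => sub_add_cancel _ _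
  have hmem : ζ + σ • v0L ∈ V0 L v0L :=
    ⟨tendsto_nhds_unique hvlim.norm (by simp [hvnorm]), ζ, hζ, σ, hσ0, hσ1, rfl⟩
  refine ⟨_, hmem, hvlim, tendsto_nhds_unique hconv ?_⟩
  exact (hpc _ hmem).tendsto.comp
    (tendsto_nhdsWithin_iff.2 ⟨hvlim, Eventually.of_forall fun i => hV0 (φ i)⟩)
end
end
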